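/- Let Ψ ∈ ℓ¹₋(ℝ) and let U : ℓ∞₋(ℝ) → ℓ∞₋(ℝ) be the convolution filter U(z) := Ψ ∗ z. Then for all u, v ∈ ℓ∞₋(ℝ), every z ∈ ℝ^{ℕ⁺} and every t ∈ ℕ⁺, |H_U(u z̃_t) − H_U(v z̃_t)| ≤ (Σ_{j=−∞}^{−t} |Ψ_j|) · ‖u − v‖_∞, where z̃_t := (z_1,…,z_t). In particular, since the tail sums Σ_{j≤−t}|Ψ_j| tend to 0 as t → ∞, the filter U has the input forgetting property. -/

import Mathlib

open Filter Topology

/-!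
Semi-infinite sequences `z : ℤ₋ → ℝ` are encoded as `ℕ → ℝ` via `n ↦ z_{-n}`.
-/

/-- Concatenation `z z̃` of `z ∈ ℝ^{ℤ₋}` with a finite word `z̃ = (z̃_1, …, z̃_T)`. -/
def concat {α : Type*} (z : ℕ → α) {T : ℕ} (w : Fin T → α) : ℕ → α := fun n =>
  if h : n < T then w ⟨T - 1 - n, by omega⟩ else z (n - T)

/-- The convolution `(Ψ ∗ z)_t = Σ_{j ≤ 0} Ψ_j z_{t+j}` in reversed indexing. -/
noncomputable def conv (Ψ : ℕ → ℝ) (z : ℕ → ℝ) (n : ℕ) : ℝ := ∑' k : ℕ, Ψ k * z (n + k)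

/-- A sequence is bounded, i.e. belongs to `ℓ∞₋`. -/
def BddSeq {E : Type*} [Norm E] (z : ℕ → E) : Prop := ∃ M : ℝ, ∀ n : ℕ, ‖z n‖ ≤ M

theorem concat_of_lt {α : Type*} (z : ℕ → α) {T : ℕ} (w : Fin T → α) {n : ℕ} (h : n < T) :
    concat z w n = w ⟨T - 1 - n, by omega⟩ := dif_pos h

theorem concat_add {α : Type*} (z : ℕ → α) {T : ℕ} (w : Fin T → α) (n : ℕ) :
    concat z w (T + n) = z n := by
  simp [concat]

theorem BddSeq.summable_mul {Ψ u : ℕ → ℝ} (hu : BddSeq u) (hΨ : Summable fun k => |Ψ k|) :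
    Summable fun k => Ψ k * u k := by
  obtain ⟨M, hM⟩ := hu
  refine Summable.of_norm_bounded (hΨ.mul_right M) fun k => ?_
  rw [norm_mul]
  exact mul_le_mul_of_nonneg_left (hM k) (norm_nonneg _)

theorem summable_abs_add {Ψ : ℕ → ℝ} (hΨ : Summable fun k => |Ψ k|) (t : ℕ) :
    Summable fun k => |Ψ (t + k)| := by
  simpa only [add_comm t] using (summable_nat_add_iff t).2 hΨ

/-- Splitting the convolution with a concatenation into the contributions of the finite word
and of the remote past. -/
theorem conv_concat_zero {Ψ u : ℕ → ℝ} (hΨ : Summable fun k => |Ψ k|) (hu : BddSeq u)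
    {T : ℕ} (w : Fin T → ℝ) :
    conv Ψ (concat u w) 0 =
      ∑ k : Fin T, Ψ k * w ⟨T - 1 - k, by omega⟩ + ∑' k, Ψ (T + k) * u k := by
  have hs : Summable fun k => Ψ k * concat u w k := by
    rw [← summable_nat_add_iff T]
    simpa only [add_comm _ T, concat_add] using hu.summable_mul (summable_abs_add hΨ T)
  simp only [conv, zero_add]
  rw [← hs.sum_add_tsum_nat_add T, Finset.sum_range]
  simp only [add_comm _ T, concat_add, concat_of_lt _ _ (Fin.is_lt _)]

theorem abs_conv_concat_sub_le {Ψ u v : ℕ → ℝ} (hΨ : Summable fun k => |Ψ k|)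
    (hu : BddSeq u) (hv : BddSeq v) {M : ℝ} (hM : ∀ n, |u n - v n| ≤ M)
    {T : ℕ} (w : Fin T → ℝ) :
    |conv Ψ (concat u w) 0 - conv Ψ (concat v w) 0| ≤ (∑' k, |Ψ (T + k)|) * M := by
  have hT := summable_abs_add hΨ T
  rw [conv_concat_zero hΨ hu, conv_concat_zero hΨ hv, add_sub_add_left_eq_sub,
    ← (hu.summable_mul hT).tsum_sub (hv.summable_mul hT)]
  refine tsum_of_norm_bounded (E := ℝ) (hT.hasSum.mul_right M) fun k => ?_
  rw [← mul_sub, norm_mul]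
  exact mul_le_mul_of_nonneg_left (hM k) (norm_nonneg _)

/-- for the convolution filter `U z := Ψ ∗ z` with `Ψ ∈ ℓ¹₋(ℝ)`, for bounded
`u`, `v` and any future `z` one has
`|H_U (u z̃_t) - H_U (v z̃_t)| ≤ (Σ_{j ≤ -t} |Ψ_j|) ‖u - v‖_∞`; since the tail sums tend
to `0`, `U` has the input forgetting property. -/
theorem stmt12 (Ψ : ℕ → ℝ) (hΨ : Summable fun k => |Ψ k|)
    (u v : ℕ → ℝ) (hu : BddSeq u) (hv : BddSeq v) (z : ℕ → ℝ) :
    (∀ M : ℝ, (∀ n : ℕ, |u n - v n| ≤ M) → ∀ t : ℕ,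
      |conv Ψ (concat u fun i : Fin t => z i) 0 - conv Ψ (concat v fun i : Fin t => z i) 0|
        ≤ (∑' k : ℕ, |Ψ (t + k)|) * M) ∧
    Tendsto (fun t : ℕ => ∑' k : ℕ, |Ψ (t + k)|) atTop (𝓝 0) ∧
    Tendsto (fun t : ℕ =>
        |conv Ψ (concat u fun i : Fin t => z i) 0
          - conv Ψ (concat v fun i : Fin t => z i) 0|)
      atTop (𝓝 0) := by
  have bound : ∀ M : ℝ, (∀ n : ℕ, |u n - v n| ≤ M) → ∀ t : ℕ,
      |conv Ψ (concat u fun i : Fin t => z i) 0 - conv Ψ (concat v fun i : Fin t => z i) 0|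
        ≤ (∑' k : ℕ, |Ψ (t + k)|) * M :=
    fun M hM t => abs_conv_concat_sub_le hΨ hu hv hM _
  have tail : Tendsto (fun t : ℕ => ∑' k : ℕ, |Ψ (t + k)|) atTop (𝓝 0) := by
    simpa only [add_comm] using tendsto_sum_nat_add fun k => |Ψ k|
  refine ⟨bound, tail, ?_⟩
  obtain ⟨A, hA⟩ := hu
  obtain ⟨B, hB⟩ := hv
  have hAB : ∀ n, |u n - v n| ≤ A + B := fun n =>
    (norm_sub_le (u n) (v n)).trans (add_le_add (hA n) (hB n))
  exact squeeze_zero (fun _ => abs_nonneg _) (bound _ hAB) (by simpa using tail.mul_const (A + B))
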